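/- arXiv:1410.2729 — 2 statements merged into one kernel-verified Lean document; each statement's English description precedes it below -/
import Mathlib

section
/- Let {S_{a^[k]}, k≥0} be a local, bounded non-stationary subdivision scheme which reproduces constants and satisfies Condition A with constants K ≥ 0, n > 0, μ < 1, and set μ̂ := μ^{1/n}. Then for every bounded initial sequence f^[0], the limit function S^∞ f^[0] is Hölder continuous with exponent |log₂ μ̂|, i.e. there is a constant L > 0 with |S^∞ f^[0](x) − S^∞ f^[0](y)| ≤ L|x − y|^{−log₂ μ̂} for all x, y ∈ ℝ with |x − y| ≤ 1. -/
open Filter Set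

/-- The subdivision operator associated to a mask `a`: `(S_a f)_i = ∑_j a_{i-2j} f_j`. -/
noncomputable def subOp (a : ℤ → ℝ) (f : ℤ → ℝ) : ℤ → ℝ :=
  fun i => ∑ᶠ j : ℤ, a (i - 2 * j) * f j

/-- The difference mask `q` of a mask `a`: `q_i = ∑_{j ≤ i} (-1)^(i-j) a_j`. -/
noncomputable def diffMask (a : ℤ → ℝ) : ℤ → ℝ :=
  fun i => ∑ᶠ j ∈ {j : ℤ | j ≤ i}, (-1 : ℝ) ^ (i - j) * a j

/-- A sequence is bounded. -/
def IsBoundedSeq (f : ℤ → ℝ) : Prop := ∃ M : ℝ, ∀ i, |f i| ≤ M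

/-- Sup-norm of a sequence. -/
noncomputable def seqNorm (f : ℤ → ℝ) : ℝ := ⨆ i : ℤ, |f i|

/-- Operator sup-norm of an operator on sequences, taken over bounded sequences of
sup-norm at most one. -/
noncomputable def opNorm (T : (ℤ → ℝ) → ℤ → ℝ) : ℝ :=
  sSup { c : ℝ | ∃ f : ℤ → ℝ, IsBoundedSeq f ∧ seqNorm f ≤ 1 ∧ c = seqNorm (T f) }

/-- The hat function `H(x) = max (1 - |x|) 0`. -/
noncomputable def hatF (x : ℝ) : ℝ := max (1 - |x|) 0

/-- The piecewise linear interpolant at level `k` of the data `f` on the grid `2^{-k} ℤ`. -/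
noncomputable def PL (k : ℕ) (f : ℤ → ℝ) : ℝ → ℝ :=
  fun x => ∑ᶠ i : ℤ, f i * hatF (2 ^ k * x - (i : ℝ))

/-- Backward difference operator on sequences. -/
def bdiff (f : ℤ → ℝ) : ℤ → ℝ := fun i => f i - f (i - 1)

/-- `compOps q k n = S_{q^[k+n-1]} ∘ ⋯ ∘ S_{q^[k+1]} ∘ S_{q^[k]}`. -/
noncomputable def compOps (q : ℕ → ℤ → ℝ) (k : ℕ) : ℕ → (ℤ → ℝ) → ℤ → ℝ
  | 0 => id
  | n + 1 => subOp (q (k + n)) ∘ compOps q k n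

/-- A mask reproduces constants: `∑_i a_{2i} = ∑_i a_{2i+1} = 1`. -/
def ReproducesConstants (a : ℤ → ℝ) : Prop :=
  (∑ᶠ i : ℤ, a (2 * i)) = 1 ∧ (∑ᶠ i : ℤ, a (2 * i + 1)) = 1

/-- Two sequences of masks are asymptotically similar. -/
def AsympSimilar (a b : ℕ → ℤ → ℝ) : Prop :=
  Tendsto (fun k => seqNorm (fun i => a k i - b k i)) atTop (nhds 0)

/-- Condition A for a non-stationary scheme with masks `a`. -/
def ConditionA (a : ℕ → ℤ → ℝ) : Prop :=
  ∃ K n : ℕ, 0 < n ∧ ∃ μ : ℝ, μ < 1 ∧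
    ∀ k, K ≤ k → opNorm (compOps (fun j => diffMask (a j)) k n) ≤ μ

def LocN (N : ℕ) (a : ℤ → ℝ) : Prop := ∀ i : ℤ, (N : ℤ) < |i| → a i = 0

lemma loc_supp {N : ℕ} {a : ℤ → ℝ} (ha : LocN N a) (f : ℤ → ℝ) (i : ℤ) :
    Function.support (fun j : ℤ => a (i - 2 * j) * f j) ⊆
      ↑(Finset.Icc ((i - N) / 2) ((i + N) / 2)) := by
  intro j hj
  have h1 : a (i - 2 * j) ≠ 0 := fun h => hj (by simp [h])
  have h2 : |i - 2 * j| ≤ (N : ℤ) := by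
    by_contra h
    exact h1 (ha _ (by omega))
  rw [abs_le] at h2
  simp only [Finset.coe_Icc, Set.mem_Icc]
  omega

lemma subOp_eq {N : ℕ} {a : ℤ → ℝ} (ha : LocN N a) (f : ℤ → ℝ) (i : ℤ) :
    subOp a f i = ∑ j ∈ Finset.Icc ((i - N) / 2) ((i + N) / 2), a (i - 2 * j) * f j :=
  finsum_eq_sum_of_support_subset _ (loc_supp ha f i)

lemma loc_sum_bound {N : ℕ} {a : ℤ → ℝ} {M : ℝ} (hM : ∀ i, |a i| ≤ M)
    (f : ℤ → ℝ) (i : ℤ) (B : ℝ)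
    (hf : ∀ j ∈ Finset.Icc ((i - N) / 2) ((i + N) / 2), |f j| ≤ B) (hB : 0 ≤ B) :
    |∑ j ∈ Finset.Icc ((i - N) / 2) ((i + N) / 2), a (i - 2 * j) * f j| ≤
      ((N : ℝ) + 2) * M * B := by
  have hM0 : 0 ≤ M := (abs_nonneg _).trans (hM 0)
  refine (Finset.abs_sum_le_sum_abs _ _).trans ?_
  refine (Finset.sum_le_card_nsmul _ _ (M * B) ?_).trans ?_
  · intro j hj
    rw [abs_mul]
    exact mul_le_mul (hM _) (hf j hj) (abs_nonneg _) hM0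
  · rw [nsmul_eq_mul, mul_assoc]
    refine mul_le_mul_of_nonneg_right ?_ (mul_nonneg hM0 hB)
    have : (Finset.Icc ((i - N) / 2) ((i + N) / 2)).card ≤ N + 2 := by
      rw [Int.card_Icc]; omega
    exact_mod_cast this

lemma subOp_bound {N : ℕ} {a : ℤ → ℝ} (ha : LocN N a) {M : ℝ} (hM : ∀ i, |a i| ≤ M)
    {f : ℤ → ℝ} {B : ℝ} (hf : ∀ j, |f j| ≤ B) (i : ℤ) :
    |subOp a f i| ≤ ((N : ℝ) + 2) * M * B := by
  rw [subOp_eq ha]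
  exact loc_sum_bound hM f i B (fun j _ => hf j) ((abs_nonneg _).trans (hf 0))

lemma subOp_smul (a : ℤ → ℝ) (c : ℝ) (f : ℤ → ℝ) :
    subOp a (fun i => c * f i) = fun i => c * subOp a f i := by
  funext i
  unfold subOp
  have := smul_finsum c (fun j : ℤ => a (i - 2 * j) * f j)
  simp only [smul_eq_mul] at this
  rw [this]
  exact finsum_congr fun j => by ring

lemma compOps_smul (q : ℕ → ℤ → ℝ) (k n : ℕ) (c : ℝ) (f : ℤ → ℝ) :
    compOps q k n (fun i => c * f i) = fun i => c * compOps q k n f i := by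
  induction n with
  | zero => rfl
  | succ n ih => simp only [compOps, Function.comp, ih, subOp_smul]

lemma compOps_bound {N : ℕ} {q : ℕ → ℤ → ℝ} (hq : ∀ k, LocN N (q k)) {M : ℝ}
    (hM : ∀ k i, |q k i| ≤ M) (k n : ℕ) {f : ℤ → ℝ} {B : ℝ} (hf : ∀ j, |f j| ≤ B) (i : ℤ) :
    |compOps q k n f i| ≤ (((N : ℝ) + 2) * M) ^ n * B := by
  induction n generalizing i with
  | zero => simpa [compOps] using hf i
  | succ n ih =>
    have := subOp_bound (hq (k + n)) (hM (k + n)) ih i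
    simp only [compOps, Function.comp]
    rw [pow_succ', mul_assoc]
    exact this

lemma opNorm_apply {N : ℕ} {q : ℕ → ℤ → ℝ} (hq : ∀ k, LocN N (q k)) {M : ℝ}
    (hM : ∀ k i, |q k i| ≤ M) (k n : ℕ) {μ : ℝ} (h : opNorm (compOps q k n) ≤ μ)
    {f : ℤ → ℝ} {B : ℝ} (hB : 0 < B) (hf : ∀ j, |f j| ≤ B) (i : ℤ) :
    |compOps q k n f i| ≤ μ * B := by
  have hbdd : BddAbove { c : ℝ | ∃ f : ℤ → ℝ, IsBoundedSeq f ∧ seqNorm f ≤ 1 ∧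
      c = seqNorm (compOps q k n f) } := by
    refine ⟨(((N : ℝ) + 2) * M) ^ n * 1, ?_⟩
    rintro c ⟨f, ⟨A, hA⟩, hf1, rfl⟩
    have h1 : ∀ j, |f j| ≤ 1 := fun j =>
      (le_ciSup (f := fun i => |f i|) ⟨A, by rintro _ ⟨i, rfl⟩; exact hA i⟩ j).trans hf1
    exact ciSup_le (compOps_bound hq hM k n h1)
  have hg : ∀ j, |B⁻¹ * f j| ≤ 1 := fun j => by
    rw [abs_mul, abs_of_pos (inv_pos.2 hB), inv_mul_le_iff₀ hB, mul_one]; exact hf j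
  have h1 : seqNorm (compOps q k n (fun j => B⁻¹ * f j)) ≤ μ :=
    (le_csSup hbdd ⟨fun j => B⁻¹ * f j, ⟨1, hg⟩, ciSup_le hg, rfl⟩).trans h
  have h2 : |compOps q k n (fun j => B⁻¹ * f j) i| ≤ μ :=
    (le_ciSup (f := fun i => |compOps q k n (fun j => B⁻¹ * f j) i|)
      ⟨_, by rintro _ ⟨i, rfl⟩; exact compOps_bound hq hM k n hg i⟩ i).trans h1
  rw [compOps_smul, abs_mul, abs_of_pos (inv_pos.2 hB), inv_mul_le_iff₀ hB] at h2
  linarith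

lemma rep_sum {a : ℤ → ℝ} (h : ReproducesConstants a) (i : ℤ) :
    ∑ᶠ j : ℤ, a (i - 2 * j) = 1 := by
  rcases Int.even_or_odd' i with ⟨c, rfl | rfl⟩
  · rw [← h.1, ← finsum_comp_equiv (Equiv.subLeft c)]
    exact finsum_congr fun j => by simp only [Equiv.subLeft_apply]; congr 1; ring
  · rw [← h.2, ← finsum_comp_equiv (Equiv.subLeft c)]
    exact finsum_congr fun j => by simp only [Equiv.subLeft_apply]; congr 1; ring

lemma supp_Icc {N : ℕ} {a b : ℤ → ℝ} (ha : LocN N a) (hb : ∀ j, a j = 0 → b j = 0) :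
    Function.support b ⊆ ↑(Finset.Icc (-(N : ℤ)) N) := by
  intro j hj
  have h2 : |j| ≤ (N : ℤ) := by
    by_contra h
    exact hj (hb j (ha _ (by omega)))
  rw [abs_le] at h2
  simpa using h2

lemma alt_sum {N : ℕ} {a : ℤ → ℝ} (ha : LocN N a) (h : ReproducesConstants a) :
    ∑ j ∈ Finset.Icc (-(N : ℤ)) N, (-1 : ℝ) ^ j * a j = 0 := by
  classical
  have e1 : ∑ j ∈ Finset.Icc (-(N : ℤ)) N, (if Even j then a j else 0) = 1 := by
    rw [← h.1, ← finsum_mem_range (f := a) (g := fun i : ℤ => 2 * i) (fun x y hxy => by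
      simpa using hxy), ← finsum_eq_sum_of_support_subset _ (supp_Icc ha (by
      intro j hj; simp [hj]))]
    refine finsum_congr fun j => ?_
    by_cases hj : Even j
    · have : j ∈ Set.range (fun i : ℤ => 2 * i) := by
        obtain ⟨c, hc⟩ := hj; exact ⟨c, by simp only; omega⟩
      rw [finsum_eq_if]; simp only [hj, this, if_true]
    · have : j ∉ Set.range (fun i : ℤ => 2 * i) := by
        rintro ⟨c, rfl⟩; exact hj (by simp)
      rw [finsum_eq_if]; simp only [hj, this, if_false]
  have e2 : ∑ j ∈ Finset.Icc (-(N : ℤ)) N, (if Even j then 0 else a j) = 1 := by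
    rw [← h.2, ← finsum_mem_range (f := a) (g := fun i : ℤ => 2 * i + 1) (fun x y hxy => by
      simpa using hxy), ← finsum_eq_sum_of_support_subset _ (supp_Icc ha (by
      intro j hj; simp [hj]))]
    refine finsum_congr fun j => ?_
    by_cases hj : Even j
    · have : j ∉ Set.range (fun i : ℤ => 2 * i + 1) := by
        rintro ⟨c, hc⟩; obtain ⟨d, hd⟩ := hj; simp only at hc; omega
      rw [finsum_eq_if]; simp only [hj, this, if_true, if_false]
    · have : j ∈ Set.range (fun i : ℤ => 2 * i + 1) := by
        obtain ⟨c, hc⟩ := Int.not_even_iff_odd.1 hj; exact ⟨c, by simp only; omega⟩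
      rw [finsum_eq_if]; simp only [hj, this, if_true, if_false]
  have := congrArg₂ (· - ·) e1 e2
  simp only [← Finset.sum_sub_distrib, sub_self] at this
  rw [← this]
  refine Finset.sum_congr rfl fun j _ => ?_
  by_cases hj : Even j
  · simp [hj, hj.neg_one_zpow]
  · simp [hj, (Int.not_even_iff_odd.1 hj).neg_one_zpow]

lemma diffMask_eq {N : ℕ} {a : ℤ → ℝ} (ha : LocN N a) (i : ℤ) :
    diffMask a i = ∑ j ∈ Finset.Icc (-(N : ℤ)) N,
      (if j ≤ i then (-1 : ℝ) ^ (i - j) * a j else 0) := by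
  rw [← finsum_eq_sum_of_support_subset _ (supp_Icc ha (by intro j hj; simp [hj]))]
  unfold diffMask
  refine finsum_congr fun j => ?_
  rw [finsum_eq_if]; rfl

lemma diffMask_loc {N : ℕ} {a : ℤ → ℝ} (ha : LocN N a) (h : ReproducesConstants a) :
    LocN N (diffMask a) := by
  intro i hi
  rw [diffMask_eq ha]
  rcases lt_abs.1 hi with hi | hi
  · have : ∑ j ∈ Finset.Icc (-(N : ℤ)) N, (if j ≤ i then (-1 : ℝ) ^ (i - j) * a j else 0)
        = (-1 : ℝ) ^ i * ∑ j ∈ Finset.Icc (-(N : ℤ)) N, (-1 : ℝ) ^ j * a j := by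
      rw [Finset.mul_sum]
      refine Finset.sum_congr rfl fun j hj => ?_
      rw [Finset.mem_Icc] at hj
      rw [if_pos (by omega), zpow_sub₀ (by norm_num), div_eq_mul_inv, ← inv_zpow, inv_neg_one]
      ring
    rw [this, alt_sum ha h, mul_zero]
  · refine Finset.sum_eq_zero fun j hj => ?_
    rw [Finset.mem_Icc] at hj
    rw [if_neg (by omega)]

lemma diffMask_bound {N : ℕ} {a : ℤ → ℝ} (ha : LocN N a) {M : ℝ} (hM : ∀ i, |a i| ≤ M) (i : ℤ) :
    |diffMask a i| ≤ (2 * (N : ℝ) + 1) * M := by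
  have hM0 : 0 ≤ M := (abs_nonneg _).trans (hM 0)
  rw [diffMask_eq ha]
  refine (Finset.abs_sum_le_sum_abs _ _).trans ?_
  refine (Finset.sum_le_card_nsmul _ _ M ?_).trans ?_
  · intro j _
    split_ifs
    · rw [abs_mul, abs_zpow]; simpa using hM j
    · simpa using hM0
  · rw [nsmul_eq_mul, Int.card_Icc]
    refine mul_le_mul_of_nonneg_right ?_ hM0
    have : ((N : ℤ) + 1 - -(N : ℤ)).toNat = 2 * N + 1 := by omega
    rw [this]; push_cast; rfl

lemma diffMask_add {N : ℕ} {a : ℤ → ℝ} (ha : LocN N a) (i : ℤ) :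
    diffMask a i + diffMask a (i - 1) = a i := by
  rw [diffMask_eq ha, diffMask_eq ha, ← Finset.sum_add_distrib]
  have : ∀ j ∈ Finset.Icc (-(N : ℤ)) N,
      ((if j ≤ i then (-1 : ℝ) ^ (i - j) * a j else 0) +
        (if j ≤ i - 1 then (-1 : ℝ) ^ (i - 1 - j) * a j else 0)) = if j = i then a j else 0 := by
    intro j _
    rcases lt_trichotomy j i with hj | hj | hj
    · rw [if_pos (by omega), if_pos (by omega), if_neg (by omega)]
      have : i - j = (i - 1 - j) + 1 := by ring
      rw [this, zpow_add_one₀ (by norm_num)]; ring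
    · subst hj; simp
    · rw [if_neg (by omega), if_neg (by omega), if_neg (by omega)]; simp
  rw [Finset.sum_congr rfl this, Finset.sum_ite_eq']
  split_ifs with hi
  · rfl
  · refine (ha i ?_).symm
    rw [Finset.mem_Icc] at hi
    rw [lt_abs]; omega

lemma bdiff_subOp {N : ℕ} {a : ℤ → ℝ} (ha : LocN N a) (h : ReproducesConstants a) (f : ℤ → ℝ) :
    bdiff (subOp a f) = subOp (diffMask a) (bdiff f) := by
  have hq := diffMask_loc ha h
  have fin : ∀ {b : ℤ → ℝ}, LocN N b → ∀ (f : ℤ → ℝ) (i : ℤ),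
      (Function.support (fun j : ℤ => b (i - 2 * j) * f j)).Finite := fun hb f i =>
    (Finset.finite_toSet _).subset (loc_supp hb f i)
  funext i
  unfold bdiff subOp
  have e1 : ∑ᶠ j : ℤ, diffMask a (i - 2 * j) * (f j - f (j - 1)) =
      ∑ᶠ j : ℤ, diffMask a (i - 2 * j) * f j -
        ∑ᶠ j : ℤ, diffMask a (i - 2 * j) * f (j - 1) := by
    rw [← finsum_sub_distrib (fin hq f i) (fin hq (fun j => f (j - 1)) i)]
    exact finsum_congr fun j => by ring
  have e2 : ∑ᶠ j : ℤ, diffMask a (i - 2 * j) * f (j - 1) =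
      ∑ᶠ j : ℤ, diffMask a (i - 2 - 2 * j) * f j := by
    rw [← finsum_comp_equiv (Equiv.subRight (1 : ℤ)) (f := fun j : ℤ => diffMask a (i - 2 - 2 * j) * f j)]
    refine finsum_congr fun j => ?_
    simp only [Equiv.subRight_apply]
    congr 2; ring
  rw [e1, e2, ← finsum_sub_distrib (fin ha f i) (fin ha f (i - 1)),
    ← finsum_sub_distrib (fin hq f i) (fin hq f (i - 2))]
  refine finsum_congr fun j => ?_
  rw [← diffMask_add ha (i - 2 * j), ← diffMask_add ha (i - 1 - 2 * j)]
  have e3 : i - 1 - 2 * j = i - 2 * j - 1 := by ring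
  have e4 : i - 2 * j - 1 - 1 = i - 2 - 2 * j := by ring
  rw [e3, e4]; ring

lemma diff_le {f : ℤ → ℝ} {d : ℝ} (hf : ∀ i, |bdiff f i| ≤ d) (m : ℤ) (p : ℕ) :
    |f (m + p) - f m| ≤ p * d := by
  induction p with
  | zero => simp
  | succ p ih =>
    have h1 := hf (m + (p + 1 : ℕ))
    unfold bdiff at h1
    have e : m + ((p + 1 : ℕ) : ℤ) - 1 = m + p := by push_cast; ring
    rw [e] at h1
    have := abs_sub_le (f (m + (p + 1 : ℕ))) (f (m + p)) (f m)
    push_cast at *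
    linarith

lemma diff_le' {f : ℤ → ℝ} {d : ℝ} (hf : ∀ i, |bdiff f i| ≤ d) (m j : ℤ) (P : ℕ)
    (h : |j - m| ≤ P) : |f j - f m| ≤ P * d := by
  have hd : 0 ≤ d := (abs_nonneg _).trans (hf 0)
  rw [abs_le] at h
  rcases le_total m j with hj | hj
  · obtain ⟨p, hp⟩ := Int.le.dest hj
    rw [← hp]
    refine (diff_le hf m p).trans (mul_le_mul_of_nonneg_right ?_ hd)
    have : p ≤ P := by omega
    exact_mod_cast this
  · obtain ⟨p, hp⟩ := Int.le.dest hj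
    rw [← hp, abs_sub_comm]
    refine (diff_le hf j p).trans (mul_le_mul_of_nonneg_right ?_ hd)
    have : p ≤ P := by omega
    exact_mod_cast this

lemma subOp_near {N : ℕ} {a : ℤ → ℝ} (ha : LocN N a) {M : ℝ} (hM : ∀ i, |a i| ≤ M)
    (h : ReproducesConstants a) {f : ℤ → ℝ} {d : ℝ} (hf : ∀ i, |bdiff f i| ≤ d) (i m : ℤ)
    (him : |i - 2 * m| ≤ 2) : |subOp a f i - f m| ≤ ((N : ℝ) + 2) * M * (((N + 2 : ℕ) : ℝ) * d) := by
  have hd : 0 ≤ d := (abs_nonneg _).trans (hf 0)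
  have e1 : f m = ∑ j ∈ Finset.Icc ((i - N) / 2) ((i + N) / 2), a (i - 2 * j) * f m := by
    rw [← Finset.sum_mul]
    have := rep_sum h i
    have s := loc_supp ha (fun _ => 1) i
    simp only [mul_one] at s
    rw [finsum_eq_sum_of_support_subset _ s] at this
    rw [this, one_mul]
  have e2 : subOp a f i - f m =
      ∑ j ∈ Finset.Icc ((i - N) / 2) ((i + N) / 2), a (i - 2 * j) * (f j - f m) := by
    rw [subOp_eq ha]
    conv_lhs => rw [e1]
    rw [← Finset.sum_sub_distrib]
    exact Finset.sum_congr rfl fun j _ => by rw [mul_sub]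
  rw [e2]
  refine loc_sum_bound hM (fun j => f j - f m) i _ ?_ (by positivity)
  intro j hj
  refine diff_le' hf m j (N + 2) ?_
  rw [Finset.mem_Icc] at hj
  rw [abs_le] at him ⊢
  push_cast
  omega

lemma PL_near (k : ℕ) (f : ℤ → ℝ) (x c E : ℝ)
    (h0 : |f ⌊(2 : ℝ) ^ k * x⌋ - c| ≤ E) (h1 : |f (⌊(2 : ℝ) ^ k * x⌋ + 1) - c| ≤ E) :
    |PL k f x - c| ≤ E := by
  unfold PL
  generalize (2 : ℝ) ^ k * x = z at *
  have hz0 := Int.floor_le z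
  have hz1 := Int.lt_floor_add_one z
  have e : ∑ᶠ i : ℤ, f i * hatF (z - (i : ℝ)) =
      f ⌊z⌋ * (1 - (z - ⌊z⌋)) + f (⌊z⌋ + 1) * (z - ⌊z⌋) := by
    rw [finsum_eq_sum_of_support_subset (s := {⌊z⌋, ⌊z⌋ + 1})]
    · rw [Finset.sum_pair (by omega)]
      have a1 : hatF (z - (⌊z⌋ : ℝ)) = 1 - (z - ⌊z⌋) := by
        unfold hatF
        rw [abs_of_nonneg (by linarith), max_eq_left (by linarith)]
      have a2 : hatF (z - ((⌊z⌋ + 1 : ℤ) : ℝ)) = z - ⌊z⌋ := by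
        unfold hatF
        push_cast
        rw [abs_of_nonpos (by linarith), max_eq_left (by linarith)]; ring
      rw [a1, a2]
    · intro i hi
      have h2 : hatF (z - i) ≠ 0 := fun h => hi (by simp [h])
      have h3 : |z - i| < 1 := by
        by_contra h
        exact h2 (by unfold hatF; exact max_eq_right (by linarith))
      rw [abs_lt] at h3
      have h4 : (i : ℝ) < ((⌊z⌋ + 2 : ℤ) : ℝ) := by push_cast; linarith
      have h5 : ((⌊z⌋ - 1 : ℤ) : ℝ) < i := by push_cast; linarith
      rw [Int.cast_lt] at h4 h5
      have : i = ⌊z⌋ ∨ i = ⌊z⌋ + 1 := by omega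
      simpa using this
  rw [e]
  have ht0 : 0 ≤ z - ⌊z⌋ := by linarith
  have ht1 : z - ⌊z⌋ ≤ 1 := by linarith
  generalize z - ⌊z⌋ = t at *
  rw [abs_le] at *
  constructor <;> nlinarith

lemma holder_pos
    (a : ℕ → ℤ → ℝ) (N : ℕ)
    (hlocal : ∀ k, LocN N (a k)) (M : ℝ) (hM : ∀ k, ∀ i : ℤ, |a k i| ≤ M)
    (hrc : ∀ k, ReproducesConstants (a k))
    (K n : ℕ) (hn : 0 < n) (μ : ℝ) (hμ0 : 0 < μ) (hμ1 : μ < 1)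
    (hA : ∀ k, K ≤ k → opNorm (compOps (fun j => diffMask (a j)) k n) ≤ μ)
    (fs : ℕ → ℤ → ℝ) (hf0 : IsBoundedSeq (fs 0))
    (hfs : ∀ k, fs (k + 1) = subOp (a k) (fs k))
    (g : ℝ → ℝ) (hg : TendstoUniformly (fun k => PL k (fs k)) g atTop) :
    0 < -Real.logb 2 (μ ^ ((1 : ℝ) / (n : ℝ))) ∧ ∃ L : ℝ, 0 < L ∧ ∀ x y : ℝ, |x - y| ≤ 1 →
        |g x - g y| ≤ L * |x - y| ^ (-Real.logb 2 (μ ^ ((1 : ℝ) / (n : ℝ)))) := by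
  set ρ : ℝ := μ ^ ((1 : ℝ) / (n : ℝ)) with hρ
  have hn' : (0 : ℝ) < n := by exact_mod_cast hn
  have hρ0 : 0 < ρ := Real.rpow_pos_of_pos hμ0 _
  have hρ1 : ρ < 1 := Real.rpow_lt_one hμ0.le hμ1 (by positivity)
  have hρn : ρ ^ n = μ := by
    rw [hρ, ← Real.rpow_natCast, ← Real.rpow_mul hμ0.le, one_div, inv_mul_cancel₀ hn'.ne',
      Real.rpow_one]
  have hα : 0 < -Real.logb 2 ρ := by
    have := Real.logb_neg (b := 2) (by norm_num) hρ0 hρ1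
    linarith
  refine ⟨hα, ?_⟩
  have hM0 : 0 ≤ M := (abs_nonneg _).trans (hM 0 0)
  have hq : ∀ k, LocN N (diffMask (a k)) := fun k => diffMask_loc (hlocal k) (hrc k)
  have hqM : ∀ k i, |diffMask (a k) i| ≤ (2 * (N : ℝ) + 1) * M := fun k i =>
    diffMask_bound (hlocal k) (hM k) i
  -- differences
  have hD : ∀ k p, bdiff (fs (k + p)) = compOps (fun j => diffMask (a j)) k p (bdiff (fs k)) := by
    intro k p
    induction p with
    | zero => rfl
    | succ p ih =>
      rw [← add_assoc, hfs, bdiff_subOp (hlocal _) (hrc _), ih]; rfl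
  have hDb : ∃ B0, ∀ i, |bdiff (fs 0) i| ≤ B0 := by
    obtain ⟨B, hB⟩ := hf0
    refine ⟨B + B, fun i => ?_⟩
    unfold bdiff
    exact (abs_sub _ _).trans (add_le_add (hB _) (hB _))
  obtain ⟨B0, hB0⟩ := hDb
  have hDk : ∀ k, ∃ B, ∀ i, |bdiff (fs k) i| ≤ B := by
    intro k
    have := hD 0 k
    rw [zero_add] at this
    rw [this]
    exact ⟨_, compOps_bound hq hqM 0 k hB0⟩
  choose Bk hBk using hDk
  have hC : ∃ C : ℝ, 0 < C ∧ ∀ k < K + n, ∀ i, |bdiff (fs k) i| ≤ C * ρ ^ k := by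
    have hBk0 : ∀ k, 0 ≤ Bk k / ρ ^ k := fun k =>
      div_nonneg ((abs_nonneg _).trans (hBk k 0)) (by positivity)
    refine ⟨1 + ∑ k ∈ Finset.range (K + n), Bk k / ρ ^ k,
      by have := Finset.sum_nonneg (s := Finset.range (K + n)) (fun k _ => hBk0 k); linarith,
      fun k hk i => (hBk k i).trans ?_⟩
    rw [← div_le_iff₀ (by positivity)]
    have := Finset.single_le_sum (f := fun k => Bk k / ρ ^ k) (fun k _ => hBk0 k)
      (Finset.mem_range.2 hk)
    linarith
  obtain ⟨C, hC0, hC⟩ := hC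
  have hd : ∀ k i, |bdiff (fs k) i| ≤ C * ρ ^ k := by
    intro k
    induction k using Nat.strong_induction_on with
    | _ k ih =>
      rcases lt_or_ge k (K + n) with hk | hk
      · exact hC k hk
      · intro i
        obtain ⟨m, rfl⟩ : ∃ m, k = m + n := ⟨k - n, by omega⟩
        rw [hD]
        refine (opNorm_apply hq hqM m n (hA m (by omega)) (by positivity)
          (ih m (by omega)) i).trans (le_of_eq ?_)
        rw [pow_add, hρn]; ring
  -- consecutive levels
  have hPL : ∀ k x, |PL k (fs k) x - fs k ⌊(2 : ℝ) ^ k * x⌋| ≤ C * ρ ^ k := by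
    intro k x
    refine PL_near k _ x _ _ (by simpa using by positivity) ?_
    have := hd k (⌊(2 : ℝ) ^ k * x⌋ + 1)
    unfold bdiff at this
    simpa using this
  set C2 : ℝ := ((N : ℝ) + 2) * M * (((N + 2 : ℕ) : ℝ) * C) with hC2
  have hC20 : 0 ≤ C2 := by positivity
  have hstep : ∀ x k, dist (PL k (fs k) x) (PL (k + 1) (fs (k + 1)) x) ≤ (C2 + C) * ρ ^ k := by
    intro x k
    have h1 := hPL k x
    have h2 : |PL (k + 1) (fs (k + 1)) x - fs k ⌊(2 : ℝ) ^ k * x⌋| ≤ C2 * ρ ^ k := by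
      have near := fun i => subOp_near (hlocal k) (hM k) (hrc k) (hd k) i ⌊(2 : ℝ) ^ k * x⌋
      have ee : ((N : ℝ) + 2) * M * (((N + 2 : ℕ) : ℝ) * (C * ρ ^ k)) = C2 * ρ ^ k := by
        rw [hC2]; ring
      rw [ee] at near
      have hfl : 2 * ⌊(2 : ℝ) ^ k * x⌋ ≤ ⌊(2 : ℝ) ^ (k + 1) * x⌋ ∧
          ⌊(2 : ℝ) ^ (k + 1) * x⌋ < 2 * ⌊(2 : ℝ) ^ k * x⌋ + 2 := by
        have a1 := Int.floor_le ((2 : ℝ) ^ k * x)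
        have a2 := Int.lt_floor_add_one ((2 : ℝ) ^ k * x)
        have e : (2 : ℝ) ^ (k + 1) * x = 2 * ((2 : ℝ) ^ k * x) := by ring
        rw [e, Int.le_floor, Int.floor_lt]
        push_cast
        constructor <;> linarith
      refine PL_near (k + 1) _ x _ _ ?_ ?_
      · rw [hfs]; exact near _ (by rw [abs_le]; omega)
      · rw [hfs]; exact near _ (by rw [abs_le]; omega)
    rw [Real.dist_eq]
    rw [abs_le] at *
    constructor <;> linarith
  have hlim : ∀ x k, |PL k (fs k) x - g x| ≤ (C2 + C) * ρ ^ k / (1 - ρ) := fun x k =>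
    dist_le_of_le_geometric_of_tendsto ρ (C2 + C) hρ1 (hstep x) (hg.tendsto_at x) k
  have h1ρ : 0 < 1 - ρ := by linarith
  set C4 : ℝ := 2 * ((C2 + C) / (1 - ρ)) + 3 * C with hC4
  have hC40 : 0 < C4 := by positivity
  have hmain : ∀ k x y, |x - y| ≤ (1 / 2 : ℝ) ^ k → |g x - g y| ≤ C4 * ρ ^ k := by
    intro k x y hxy
    have h1 := hlim x k
    have h2 := hlim y k
    have h3 := hPL k x
    have h4 := hPL k y
    have h5 : |fs k ⌊(2 : ℝ) ^ k * x⌋ - fs k ⌊(2 : ℝ) ^ k * y⌋| ≤ ((1 : ℕ) : ℝ) * (C * ρ ^ k) := by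
      refine diff_le' (hd k) _ _ 1 ?_
      have h2k : (0 : ℝ) < 2 ^ k := by positivity
      have e : (2 : ℝ) ^ k * (1 / 2 : ℝ) ^ k = 1 := by rw [← mul_pow]; norm_num
      have hz : |(2 : ℝ) ^ k * x - (2 : ℝ) ^ k * y| ≤ 1 := by
        rw [← mul_sub, abs_mul, abs_of_pos h2k, ← e]
        exact mul_le_mul_of_nonneg_left hxy h2k.le
      rw [abs_le] at hz
      have a1 := Int.floor_le ((2 : ℝ) ^ k * x)
      have a2 := Int.lt_floor_add_one ((2 : ℝ) ^ k * x)
      have a3 := Int.floor_le ((2 : ℝ) ^ k * y)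
      have a4 := Int.lt_floor_add_one ((2 : ℝ) ^ k * y)
      have b1 : ((⌊(2 : ℝ) ^ k * x⌋ : ℤ) : ℝ) < ((⌊(2 : ℝ) ^ k * y⌋ + 2 : ℤ) : ℝ) := by
        push_cast; linarith
      have b2 : ((⌊(2 : ℝ) ^ k * y⌋ : ℤ) : ℝ) < ((⌊(2 : ℝ) ^ k * x⌋ + 2 : ℤ) : ℝ) := by
        push_cast; linarith
      rw [Int.cast_lt] at b1 b2
      rw [abs_le]; push_cast; omega
    have e : C4 * ρ ^ k = 2 * ((C2 + C) * ρ ^ k / (1 - ρ)) + 3 * (C * ρ ^ k) := by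
      rw [hC4]; ring
    rw [e]
    push_cast at h5
    generalize (C2 + C) * ρ ^ k / (1 - ρ) = E at *
    rw [abs_le] at *
    constructor <;> linarith
  refine ⟨C4 / ρ, by positivity, fun x y hxy => ?_⟩
  rcases eq_or_ne x y with rfl | hne
  · simp only [sub_self, abs_zero]; positivity
  have hpos : 0 < |x - y| := abs_pos.2 (sub_ne_zero.2 hne)
  obtain ⟨k, hk1, hk2⟩ := exists_nat_pow_near_of_lt_one hpos hxy
    (by norm_num : (0 : ℝ) < 1 / 2) (by norm_num)
  refine (hmain k x y hk2).trans ?_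
  have e1 : ((1 / 2 : ℝ) ^ (k + 1)) ^ (-Real.logb 2 ρ) = ρ ^ (k + 1) := by
    rw [← Real.rpow_natCast, ← Real.rpow_mul (by norm_num), mul_comm, Real.rpow_mul (by norm_num),
      Real.rpow_natCast]
    congr 1
    rw [one_div, Real.inv_rpow (by norm_num), Real.rpow_neg (by norm_num), inv_inv,
      Real.rpow_logb (by norm_num) (by norm_num) hρ0]
  have e2 : ρ ^ (k + 1) ≤ |x - y| ^ (-Real.logb 2 ρ) := by
    rw [← e1]
    exact Real.rpow_le_rpow (by positivity) hk1.le hα.le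
  calc C4 * ρ ^ k = C4 / ρ * ρ ^ (k + 1) := by rw [pow_succ]; field_simp
    _ ≤ _ := mul_le_mul_of_nonneg_left e2 (by positivity)

/-- under the hypotheses of the convergence theorem (Condition A with
constants `K`, `n`, `μ`, `μ̂ = μ^{1/n}`), the limit function is Hölder continuous with
exponent `|log₂ μ̂| = -log₂ μ̂`. -/
theorem limit_function_holder
    (a : ℕ → ℤ → ℝ) (N : ℕ) (hN : 0 < N)
    (hlocal : ∀ k, ∀ i : ℤ, (N : ℤ) < |i| → a k i = 0)
    (hbdd : ∃ M : ℝ, ∀ k, ∀ i : ℤ, |a k i| ≤ M)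
    (hrc : ∀ k, ReproducesConstants (a k))
    (K n : ℕ) (hn : 0 < n) (μ : ℝ) (hμ0 : 0 ≤ μ) (hμ1 : μ < 1)
    (hA : ∀ k, K ≤ k → opNorm (compOps (fun j => diffMask (a j)) k n) ≤ μ) :
    ∀ f0 : ℤ → ℝ, IsBoundedSeq f0 → ∀ fs : ℕ → ℤ → ℝ, fs 0 = f0 →
      (∀ k, fs (k + 1) = subOp (a k) (fs k)) →
      ∀ g : ℝ → ℝ, TendstoUniformly (fun k => PL k (fs k)) g atTop →
      ∃ L : ℝ, 0 < L ∧ ∀ x y : ℝ, |x - y| ≤ 1 →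
        |g x - g y| ≤ L * |x - y| ^ (-Real.logb 2 (μ ^ ((1 : ℝ) / (n : ℝ)))) := by
  intro f0 hf0 fs hfs0 hfs g hg
  obtain ⟨M, hM⟩ := hbdd
  subst hfs0
  rcases hμ0.eq_or_lt with h0 | h0
  · subst h0
    obtain ⟨hα, L, hL, h⟩ := holder_pos a N hlocal M hM hrc K n hn (1 / 2) (by norm_num)
      (by norm_num) (fun k hk => (hA k hk).trans (by norm_num)) fs hf0 hfs g hg
    refine ⟨L, hL, fun x y hxy => (h x y hxy).trans (mul_le_mul_of_nonneg_left ?_ hL.le)⟩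
    have hn' : (1 : ℝ) / (n : ℝ) ≠ 0 := by positivity
    rw [Real.zero_rpow hn', Real.logb_zero, neg_zero, Real.rpow_zero]
    exact Real.rpow_le_one (abs_nonneg _) hxy hα.le
  · exact (holder_pos a N hlocal M hM hrc K n hn μ h0 hμ1 hA fs hf0 hfs g hg).2
end

section
/- Fix γ > 0 and a sequence ε_k → 0 with γ_k := γ + ε_k > 0 for all k ≥ 0, and let a^[k] be the non-stationary de Rham masks, a^[k]_0 = a^[k]_3 = 1/(2+γ_k), a^[k]_1 = a^[k]_2 = (1+γ_k)/(2+γ_k), a^[k]_i = 0 otherwise. Then the non-stationary subdivision scheme {S_{a^[k]}, k≥0} converges: for every bounded initial sequence f^[0], the piecewise linear interpolants PL(f^[k]) of the generated data f^[k+1] = S_{a^[k]} f^[k] converge uniformly on ℝ. -/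
open Filter Set

theorem subOp_aux (w v : ℝ) (f : ℤ → ℝ) (a : ℤ → ℝ)
    (ha : a = fun i => if i = 0 ∨ i = 3 then w else if i = 1 ∨ i = 2 then v else 0) (n : ℤ) :
    subOp a f (2 * n) = w * f n + v * f (n - 1) ∧
    subOp a f (2 * n + 1) = v * f n + w * f (n - 1) := by
  have key : ∀ i : ℤ, (i = 2 * n ∨ i = 2 * n + 1) →
      subOp a f i = a (i - 2 * n) * f n + a (i - 2 * (n - 1)) * f (n - 1) := by
    intro i hi
    unfold subOp
    rw [finsum_eq_sum_of_support_subset (s := {n, n - 1})]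
    · rw [Finset.sum_pair (by omega)]
    · intro j hj
      simp only [Finset.coe_insert, Finset.coe_singleton, Set.mem_insert_iff,
        Set.mem_singleton_iff]
      by_contra hcon
      apply hj
      have : a (i - 2 * j) = 0 := by
        rw [ha]
        simp only
        rw [if_neg (by omega), if_neg (by omega)]
      simp [this]
  constructor
  · rw [key _ (Or.inl rfl), ha]
    simp only
    rw [if_pos (by omega), if_neg (by omega), if_pos (by omega)]
  · rw [key _ (Or.inr rfl), ha]
    simp only
    rw [if_neg (by omega), if_pos (by omega), if_pos (by omega)]

theorem PL_aux (k : ℕ) (f : ℤ → ℝ) (x : ℝ) (n : ℤ) (h1 : (n : ℝ) ≤ 2 ^ k * x)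
    (h2 : 2 ^ k * x ≤ n + 1) (c D : ℝ) (hf1 : |f n - c| ≤ D) (hf2 : |f (n + 1) - c| ≤ D) :
    |PL k f x - c| ≤ D := by
  have key : PL k f x = f n * (1 - (2 ^ k * x - n)) + f (n + 1) * (2 ^ k * x - n) := by
    unfold PL
    rw [finsum_eq_sum_of_support_subset (s := {n, n + 1})]
    · rw [Finset.sum_pair (by omega)]
      unfold hatF
      push_cast
      rw [abs_of_nonneg (by linarith), abs_of_nonpos (by linarith), max_eq_left (by linarith),
        max_eq_left (by linarith)]
      ring
    · intro j hj
      simp only [Finset.coe_insert, Finset.coe_singleton, Set.mem_insert_iff,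
        Set.mem_singleton_iff]
      by_contra hcon
      apply hj
      have : hatF (2 ^ k * x - j) = 0 := by
        unfold hatF
        apply max_eq_right
        rcases lt_or_ge j n with h | h
        · have : (j : ℝ) + 1 ≤ n := by exact_mod_cast h
          have := le_abs_self (2 ^ k * x - (j : ℝ))
          linarith
        · have : n + 2 ≤ j := by omega
          have : (n : ℝ) + 2 ≤ j := by exact_mod_cast this
          have := neg_abs_le (2 ^ k * x - (j : ℝ))
          linarith
      simp [this]
  rw [key]
  generalize 2 ^ k * x = y at *
  rw [abs_le] at *
  constructor <;> nlinarith [mul_nonneg (sub_nonneg.2 h1) (sub_nonneg.2 hf1.1),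
    mul_nonneg (sub_nonneg.2 h1) (sub_nonneg.2 hf1.2),
    mul_nonneg (sub_nonneg.2 h2) (sub_nonneg.2 hf1.1),
    mul_nonneg (sub_nonneg.2 h2) (sub_nonneg.2 hf1.2),
    mul_nonneg (sub_nonneg.2 h1) (sub_nonneg.2 hf2.1),
    mul_nonneg (sub_nonneg.2 h1) (sub_nonneg.2 hf2.2),
    mul_nonneg (sub_nonneg.2 h2) (sub_nonneg.2 hf2.1),
    mul_nonneg (sub_nonneg.2 h2) (sub_nonneg.2 hf2.2)]

/-- the non-stationary de Rham scheme with ratios `1 : γₖ : 1`,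
`γₖ = γ + εₖ → γ > 0`, converges: for every bounded initial data the piecewise linear
interpolants of the generated data converge uniformly on `ℝ`. -/
theorem deRham_convergence
    (γ : ℝ) (hγ : 0 < γ) (ε : ℕ → ℝ) (hε : Tendsto ε atTop (nhds 0))
    (γk : ℕ → ℝ) (hγk : ∀ k, γk k = γ + ε k) (hγkpos : ∀ k, 0 < γk k)
    (a : ℕ → ℤ → ℝ)
    (ha : ∀ k, a k = fun i => if i = 0 ∨ i = 3 then 1 / (2 + γk k)
        else if i = 1 ∨ i = 2 then (1 + γk k) / (2 + γk k) else 0) :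
    ∀ f0 : ℤ → ℝ, IsBoundedSeq f0 → ∀ fs : ℕ → ℤ → ℝ, fs 0 = f0 →
      (∀ k, fs (k + 1) = subOp (a k) (fs k)) →
      ∃ g : ℝ → ℝ, TendstoUniformly (fun k => PL k (fs k)) g atTop := by
  intro f0 hf0 fs hfs0 hfs
  have hlim : Tendsto γk atTop (nhds γ) := by
    have : γk = fun k => γ + ε k := funext hγk
    rw [this]
    simpa using hε.const_add γ
  set w : ℕ → ℝ := fun k => 1 / (2 + γk k) with hw
  have hwlim : Tendsto (fun k => (max (2 * w k) (1 - 2 * w k)) / (1 - max (2 * w k) (1 - 2 * w k)))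
      atTop (nhds (max (2 * (1 / (2 + γ))) (1 - 2 * (1 / (2 + γ))) /
        (1 - max (2 * (1 / (2 + γ))) (1 - 2 * (1 / (2 + γ)))))) := by
    have h1 : Tendsto w atTop (nhds (1 / (2 + γ))) :=
      tendsto_const_nhds.div (hlim.const_add 2) (by positivity)
    have h2 := (h1.const_mul 2).max ((h1.const_mul 2).const_sub 1)
    refine h2.div (h2.const_sub 1) ?_
    have h3 : 2 * (1 / (2 + γ)) < 1 := by
      rw [mul_one_div, div_lt_one (by positivity)]; linarith
    have h4 : 0 < 1 / (2 + γ) := by positivity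
    have := max_lt h3 (by linarith : 1 - 2 * (1 / (2 + γ)) < 1)
    linarith
  obtain ⟨M, hM⟩ := hwlim.bddAbove_range
  have hw0 : ∀ k, 0 < w k := fun k => by have := hγkpos k; simp only [hw]; positivity
  have hw1 : ∀ k, 2 * w k < 1 := fun k => by
    have := hγkpos k
    simp only [hw]
    rw [mul_one_div, div_lt_one (by positivity)]; linarith
  have hmu : ∃ r : ℝ, 0 ≤ r ∧ r < 1 ∧ ∀ k, 2 * w k ≤ r ∧ 1 - 2 * w k ≤ r := by
    have hM' : ∀ k, (max (2 * w k) (1 - 2 * w k)) ≤ M * (1 - max (2 * w k) (1 - 2 * w k)) := by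
      intro k
      have h := hM (Set.mem_range_self k)
      have := max_lt (hw1 k) (by linarith [hw0 k] : 1 - 2 * w k < 1)
      rwa [div_le_iff₀ (by linarith)] at h
    have hMpos : 0 ≤ M := by
      by_contra hneg
      push Not at hneg
      have h := hM' 0
      have h1 := max_lt (hw1 0) (by linarith [hw0 0] : 1 - 2 * w 0 < 1)
      have h2 := le_max_left (2 * w 0) (1 - 2 * w 0)
      nlinarith [hw0 0]
    refine ⟨M / (1 + M), by positivity, by rw [div_lt_one (by positivity)]; linarith, fun k => ?_⟩
    have : max (2 * w k) (1 - 2 * w k) ≤ M / (1 + M) := by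
      rw [le_div_iff₀ (by positivity)]
      linarith [hM' k]
    exact ⟨(le_max_left _ _).trans this, (le_max_right _ _).trans this⟩
  obtain ⟨r, hr0, hr1, hr⟩ := hmu
  have hstep : ∀ k n, fs (k + 1) (2 * n) = w k * fs k n + (1 - w k) * fs k (n - 1) ∧
      fs (k + 1) (2 * n + 1) = (1 - w k) * fs k n + w k * fs k (n - 1) := by
    intro k n
    rw [hfs k]
    have : (1 + γk k) / (2 + γk k) = 1 - w k := by
      have := hγkpos k
      simp only [hw]; field_simp; ring
    rw [← this]
    exact subOp_aux _ _ _ _ (ha k) n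
  obtain ⟨B, hB⟩ := hf0
  have hd : ∀ k n, |fs k n - fs k (n - 1)| ≤ (2 * B) * r ^ k := by
    intro k
    induction k with
    | zero =>
      intro n
      rw [hfs0]
      have := abs_sub (f0 n) (f0 (n - 1))
      linarith [hB n, hB (n - 1)]
    | succ k ih =>
      intro n
      have hD : 0 ≤ 2 * B * r ^ k := (abs_nonneg _).trans (ih 0)
      have hr' := hr k
      have hwk := hw0 k
      have hwk1 := hw1 k
      rw [pow_succ, ← mul_assoc]
      generalize 2 * B * r ^ k = D at *
      rcases Int.even_or_odd' n with ⟨m, rfl | rfl⟩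
      · have e : 2 * m - 1 = 2 * (m - 1) + 1 := by ring
        rw [e, (hstep k m).1, (hstep k (m - 1)).2]
        have i1 := abs_le.1 (ih m)
        have i2 := abs_le.1 (ih (m - 1))
        rw [abs_le]
        constructor <;> nlinarith
      · have e : 2 * m + 1 - 1 = 2 * m := by ring
        rw [e, (hstep k m).1, (hstep k m).2]
        have i1 := abs_le.1 (ih m)
        rw [abs_le]
        constructor <;> nlinarith
  have hPL : ∀ x k, dist (PL k (fs k) x) (PL (k + 1) (fs (k + 1)) x) ≤ (4 * B) * r ^ k := by
    intro x k
    have hdk := hd k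
    have e4 : 4 * B * r ^ k = 2 * B * r ^ k + 2 * B * r ^ k := by ring
    rw [e4]
    have hD : 0 ≤ 2 * B * r ^ k := (abs_nonneg _).trans (hdk 0)
    generalize 2 * B * r ^ k = D at *
    set n := ⌊2 ^ k * x⌋ with hn
    have h1 : (n : ℝ) ≤ 2 ^ k * x := Int.floor_le _
    have h2 : 2 ^ k * x ≤ n + 1 := (Int.lt_floor_add_one _).le
    have hwk := hw0 k
    have hwk1 := hw1 k
    have d1 := hdk n
    have d2 := hdk (n + 1)
    rw [show n + 1 - 1 = n by ring] at d2
    have A := PL_aux k (fs k) x n h1 h2 (fs k n) D (by simpa using hD) d2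
    have E0 : |fs (k + 1) (2 * n) - fs k n| ≤ D := by
      rw [(hstep k n).1]
      rw [abs_le] at *
      constructor <;> nlinarith
    have E1 : |fs (k + 1) (2 * n + 1) - fs k n| ≤ D := by
      rw [(hstep k n).2]
      rw [abs_le] at *
      constructor <;> nlinarith
    have E2 : |fs (k + 1) (2 * n + 1 + 1) - fs k n| ≤ D := by
      rw [show 2 * n + 1 + 1 = 2 * (n + 1) by ring, (hstep k (n + 1)).1,
        show n + 1 - 1 = n by ring]
      rw [abs_le] at *
      constructor <;> nlinarith
    have C : |PL (k + 1) (fs (k + 1)) x - fs k n| ≤ D := by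
      have hp : (2 : ℝ) ^ (k + 1) * x = 2 * (2 ^ k * x) := by ring
      rcases le_total (2 ^ (k + 1) * x) (2 * (n : ℝ) + 1) with h | h
      · exact PL_aux (k + 1) _ x (2 * n) (by push_cast; linarith) (by push_cast; linarith) _ _ E0 E1
      · exact PL_aux (k + 1) _ x (2 * n + 1) (by push_cast; linarith) (by push_cast; linarith)
          _ _ E1 E2
    rw [Real.dist_eq]
    rw [abs_le] at *
    constructor <;> linarith
  have hconv : ∀ x, ∃ l, Tendsto (fun k => PL k (fs k) x) atTop (nhds l) := fun x =>
    cauchySeq_tendsto_of_complete (cauchySeq_of_le_geometric r (4 * B) hr1 (hPL x))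
  choose g hg using hconv
  refine ⟨g, ?_⟩
  rw [Metric.tendstoUniformly_iff]
  intro δ hδ
  have hz : Tendsto (fun k => 4 * B * r ^ k / (1 - r)) atTop (nhds 0) := by
    have := ((tendsto_pow_atTop_nhds_zero_of_lt_one hr0 hr1).const_mul (4 * B)).div_const (1 - r)
    simpa using this
  filter_upwards [hz.eventually (gt_mem_nhds hδ)] with k hk x
  rw [dist_comm]
  exact (dist_le_of_le_geometric_of_tendsto r (4 * B) hr1 (hPL x) (hg x) k).trans_lt hk
end
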